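/- The symbolic Rees algebra of the Fermat ideal is Noetherian: the subring 𝒮 = { p ∈ R[t] : for every i ≥ 0, the coefficient of t^i in p lies in I^{(i)} } of the polynomial ring R[t] (where I^{(0)} = R) is a Noetherian ring. -/

import Mathlib

open MvPolynomial

noncomputable section

/-- `f = yⁿ − zⁿ` in `K[x,y,z]` (variables `x = X 0`, `y = X 1`, `z = X 2`). -/
def pf (K : Type*) [Field K] (n : ℕ) : MvPolynomial (Fin 3) K := X 1 ^ n - X 2 ^ n

/-- `g = zⁿ − xⁿ`. -/
def pg (K : Type*) [Field K] (n : ℕ) : MvPolynomial (Fin 3) K := X 2 ^ n - X 0 ^ n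

/-- `h = xⁿ − yⁿ`. -/
def ph (K : Type*) [Field K] (n : ℕ) : MvPolynomial (Fin 3) K := X 0 ^ n - X 1 ^ n

/-- The ideal `(f, g)`. -/
def Ifg (K : Type*) [Field K] (n : ℕ) : Ideal (MvPolynomial (Fin 3) K) :=
  Ideal.span {pf K n, pg K n}

/-- The ideal `(x, y)`. -/
def Ixy (K : Type*) [Field K] : Ideal (MvPolynomial (Fin 3) K) := Ideal.span {X 0, X 1}

/-- The ideal `(y, z)`. -/
def Iyz (K : Type*) [Field K] : Ideal (MvPolynomial (Fin 3) K) := Ideal.span {X 1, X 2}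

/-- The ideal `(z, x)`. -/
def Izx (K : Type*) [Field K] : Ideal (MvPolynomial (Fin 3) K) := Ideal.span {X 2, X 0}

/-- The `m`-th symbolic power of the Fermat ideal `I = (xf, yg, zh)`:
`I^{(m)} = (f,g)^m ∩ (x,y)^m ∩ (y,z)^m ∩ (z,x)^m`. -/
def symbPow (K : Type*) [Field K] (n m : ℕ) : Ideal (MvPolynomial (Fin 3) K) :=
  Ifg K n ^ m ⊓ Ixy K ^ m ⊓ Iyz K ^ m ⊓ Izx K ^ m

/-- Monomials in the six lines joining two of the four points `[1:1:1], [0:0:1], [1:0:0], [0:1:0]`. -/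
def lineMonomial (K : Type*) [Field K] (a : Fin 6 → ℕ) : MvPolynomial (Fin 3) K :=
  X 0 ^ a 0 * X 1 ^ a 1 * X 2 ^ a 2 * (X 1 - X 2) ^ a 3 * (X 2 - X 0) ^ a 4 * (X 0 - X 1) ^ a 5

/-- The `K`-algebra map `K[x,y,z] → K[x,y,z][s]` scaling the equations of the `i`-th point by `s`;
the order of vanishing of `p` at that point is the `s`-adic order of its image. -/
def blowup (K : Type*) [Field K] :
    Fin 4 → (MvPolynomial (Fin 3) K →ₐ[K] Polynomial (MvPolynomial (Fin 3) K)) :=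
  ![aeval ![.C (X 2) + .X * .C (X 0 - X 2), .C (X 2) + .X * .C (X 1 - X 2), .C (X 2)],
    aeval ![.X * .C (X 0), .X * .C (X 1), .C (X 2)],
    aeval ![.C (X 0), .X * .C (X 1), .X * .C (X 2)],
    aeval ![.X * .C (X 0), .C (X 1), .X * .C (X 2)]]

/-- Forms of degree `d` vanishing to order at least `m i` at the `i`-th point. -/
def fatForms (K : Type*) [Field K] (d : ℕ) (m : Fin 4 → ℕ) :
    Submodule K (MvPolynomial (Fin 3) K) where
  carrier := {p | p.IsHomogeneous d ∧ ∀ i, Polynomial.X ^ m i ∣ blowup K i p}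
  add_mem' := fun ha hb => ⟨ha.1.add hb.1, fun i => by
    rw [map_add]; exact dvd_add (ha.2 i) (hb.2 i)⟩
  zero_mem' := ⟨isHomogeneous_zero _ _ _, fun i => by simp⟩
  smul_mem' := fun c p hp => ⟨by
    rw [smul_eq_C_mul]; exact hp.1.C_mul c, fun i => by
    rw [map_smul, Algebra.smul_def]; exact Dvd.dvd.mul_left (hp.2 i) _⟩

/-- The number of lines of the arrangement `a` through the `i`-th point. -/
def lineOrder (a : Fin 6 → ℕ) : Fin 4 → ℕ :=
  ![a 3 + a 4 + a 5, a 0 + a 1 + a 5, a 1 + a 2 + a 3, a 0 + a 2 + a 4]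

/-- The `K`-span of the products of `d` lines that vanish to order at least `m`. -/
def lineSpan (K : Type*) [Field K] (d : ℕ) (m : Fin 4 → ℕ) :
    Submodule K (MvPolynomial (Fin 3) K) :=
  Submodule.span K {p | ∃ a : Fin 6 → ℕ, ∑ i, a i = d ∧ (∀ i, m i ≤ lineOrder a i) ∧
    p = lineMonomial K a}

section FatPoints

variable {K : Type*} [Field K]

lemma lineMonomial_isHomogeneous (a : Fin 6 → ℕ) :
    (lineMonomial K a).IsHomogeneous (∑ i, a i) := by
  have h (i j : Fin 3) (k : ℕ) : ((X i - X j : MvPolynomial (Fin 3) K) ^ k).IsHomogeneous k := by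
    simpa using ((isHomogeneous_X K i).sub (isHomogeneous_X K j)).pow k
  rw [Fin.sum_univ_six]
  exact (((((isHomogeneous_X_pow _ _).mul (isHomogeneous_X_pow _ _)).mul
    (isHomogeneous_X_pow _ _)).mul (h _ _ _)).mul (h _ _ _)).mul (h _ _ _)

lemma pow_lineOrder_dvd_blowup (a : Fin 6 → ℕ) (i : Fin 4) :
    Polynomial.X ^ lineOrder a i ∣ blowup K i (lineMonomial K a) := by
  simp only [lineMonomial, map_mul, map_pow]
  match i with
  | 0 =>
    have e₃ : blowup K 0 (X 1 - X 2) = .X * .C (X 1 - X 2) := by simp [blowup]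
    have e₄ : blowup K 0 (X 2 - X 0) = .X * .C (X 2 - X 0) := by simp [blowup]; ring
    have e₅ : blowup K 0 (X 0 - X 1) = .X * .C (X 0 - X 1) := by simp [blowup]; ring
    rw [e₃, e₄, e₅]
    exact ⟨blowup K 0 (X 0) ^ a 0 * blowup K 0 (X 1) ^ a 1 * blowup K 0 (X 2) ^ a 2 *
      .C (X 1 - X 2) ^ a 3 * .C (X 2 - X 0) ^ a 4 * .C (X 0 - X 1) ^ a 5, by
        simp only [lineOrder, Matrix.cons_val, mul_pow, pow_add]; ring⟩
  | 1 =>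
    have e₀ : blowup K 1 (X 0) = .X * .C (X 0) := by simp [blowup]
    have e₁ : blowup K 1 (X 1) = .X * .C (X 1) := by simp [blowup]
    have e₅ : blowup K 1 (X 0 - X 1) = .X * .C (X 0 - X 1) := by simp [blowup]; ring
    rw [e₀, e₁, e₅]
    exact ⟨.C (X 0) ^ a 0 * .C (X 1) ^ a 1 * blowup K 1 (X 2) ^ a 2 *
      blowup K 1 (X 1 - X 2) ^ a 3 * blowup K 1 (X 2 - X 0) ^ a 4 * .C (X 0 - X 1) ^ a 5, by
        simp only [lineOrder, Matrix.cons_val, mul_pow, pow_add]; ring⟩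
  | 2 =>
    have e₁ : blowup K 2 (X 1) = .X * .C (X 1) := by simp [blowup]
    have e₂ : blowup K 2 (X 2) = .X * .C (X 2) := by simp [blowup]
    have e₃ : blowup K 2 (X 1 - X 2) = .X * .C (X 1 - X 2) := by simp [blowup]; ring
    rw [e₁, e₂, e₃]
    exact ⟨blowup K 2 (X 0) ^ a 0 * .C (X 1) ^ a 1 * .C (X 2) ^ a 2 *
      .C (X 1 - X 2) ^ a 3 * blowup K 2 (X 2 - X 0) ^ a 4 * blowup K 2 (X 0 - X 1) ^ a 5, by
        simp only [lineOrder, Matrix.cons_val, mul_pow, pow_add]; ring⟩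
  | 3 =>
    have e₀ : blowup K 3 (X 0) = .X * .C (X 0) := by simp [blowup]
    have e₂ : blowup K 3 (X 2) = .X * .C (X 2) := by simp [blowup]
    have e₄ : blowup K 3 (X 2 - X 0) = .X * .C (X 2 - X 0) := by simp [blowup]; ring
    rw [e₀, e₂, e₄]
    exact ⟨.C (X 0) ^ a 0 * blowup K 3 (X 1) ^ a 1 * .C (X 2) ^ a 2 *
      blowup K 3 (X 1 - X 2) ^ a 3 * .C (X 2 - X 0) ^ a 4 * blowup K 3 (X 0 - X 1) ^ a 5, by
        simp only [lineOrder, Matrix.cons_val, mul_pow, pow_add]; ring⟩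

lemma lineSpan_le_fatForms (d : ℕ) (m : Fin 4 → ℕ) : lineSpan K d m ≤ fatForms K d m := by
  refine Submodule.span_le.2 ?_
  rintro _ ⟨a, rfl, hm, rfl⟩
  exact ⟨lineMonomial_isHomogeneous a,
    fun i => (pow_dvd_pow _ (hm i)).trans (pow_lineOrder_dvd_blowup a i)⟩

lemma pow_dvd_of_not_dvd {A : Type*} [CommRing A] [IsDomain A] {c q : Polynomial A} {m : ℕ}
    (hc : c.coeff 0 ≠ 0) (h : Polynomial.X ^ m ∣ c * q) : Polynomial.X ^ m ∣ q :=
  Polynomial.prime_X.pow_dvd_of_dvd_mul_left m (by rwa [Polynomial.X_dvd_iff]) h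

lemma pow_pred_dvd_of_not_dvd {A : Type*} [CommRing A] [IsDomain A] {c q : Polynomial A} {m : ℕ}
    (hc : c.coeff 0 ≠ 0) (h : Polynomial.X ^ m ∣ Polynomial.X * c * q) :
    Polynomial.X ^ (m - 1) ∣ q := by
  cases m with
  | zero => simp
  | succ k =>
    rw [pow_succ', mul_assoc] at h
    exact pow_dvd_of_not_dvd hc ((mul_dvd_mul_iff_left Polynomial.X_ne_zero).1 h)

lemma X_sub_X_ne_zero {i j : Fin 3} (h : i ≠ j) : (X i - X j : MvPolynomial (Fin 3) K) ≠ 0 :=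
  sub_ne_zero.2 fun e => h (X_injective e)

lemma blowup_dvd_of_mul_X_sub_X {m : Fin 4 → ℕ} {q : MvPolynomial (Fin 3) K}
    (h : ∀ i, Polynomial.X ^ m i ∣ blowup K i ((X 0 - X 1) * q)) (i : Fin 4) :
    Polynomial.X ^ (![m 0 - 1, m 1 - 1, m 2, m 3] i) ∣ blowup K i q := by
  simp only [map_mul] at h
  have h0 : Polynomial.X ^ (m 0 - 1) ∣ blowup K 0 q := by
    refine pow_pred_dvd_of_not_dvd (c := .C (X 0 - X 1))
      (by simpa using X_sub_X_ne_zero (by decide)) ?_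
    rw [show Polynomial.X * Polynomial.C (X 0 - X 1) = blowup K 0 (X 0 - X 1) by
      simp [blowup]; ring]
    exact h 0
  have h1 : Polynomial.X ^ (m 1 - 1) ∣ blowup K 1 q := by
    refine pow_pred_dvd_of_not_dvd (c := .C (X 0 - X 1))
      (by simpa using X_sub_X_ne_zero (by decide)) ?_
    rw [show Polynomial.X * Polynomial.C (X 0 - X 1) = blowup K 1 (X 0 - X 1) by
      simp [blowup]; ring]
    exact h 1
  have h2 : Polynomial.X ^ m 2 ∣ blowup K 2 q := pow_dvd_of_not_dvd (by simp [blowup]) (h 2)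
  have h3 : Polynomial.X ^ m 3 ∣ blowup K 3 q := pow_dvd_of_not_dvd (by simp [blowup]) (h 3)
  revert i
  simp [Fin.forall_fin_succ, h0, h1, h2, h3]

lemma blowup_dvd_of_mul_X {m : Fin 4 → ℕ} {q : MvPolynomial (Fin 3) K}
    (h : ∀ i, Polynomial.X ^ m i ∣ blowup K i (X 2 * q)) (i : Fin 4) :
    Polynomial.X ^ (![m 0, m 1, m 2 - 1, m 3 - 1] i) ∣ blowup K i q := by
  simp only [map_mul] at h
  have h0 : Polynomial.X ^ m 0 ∣ blowup K 0 q := pow_dvd_of_not_dvd (by simp [blowup]) (h 0)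
  have h1 : Polynomial.X ^ m 1 ∣ blowup K 1 q := pow_dvd_of_not_dvd (by simp [blowup]) (h 1)
  have h2 : Polynomial.X ^ (m 2 - 1) ∣ blowup K 2 q := by
    refine pow_pred_dvd_of_not_dvd (c := .C (X 2)) (by simp) ?_
    rw [show Polynomial.X * Polynomial.C (X 2) = blowup K 2 (X 2) by simp [blowup]]
    exact h 2
  have h3 : Polynomial.X ^ (m 3 - 1) ∣ blowup K 3 q := by
    refine pow_pred_dvd_of_not_dvd (c := .C (X 2)) (by simp) ?_
    rw [show Polynomial.X * Polynomial.C (X 2) = blowup K 3 (X 2) by simp [blowup]]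
    exact h 3
  revert i
  simp [Fin.forall_fin_succ, h0, h1, h2, h3]

attribute [local instance] MvPolynomial.gradedAlgebra in
lemma homogeneousComponent_mul_of_isHomogeneous {σ : Type*} {L : MvPolynomial σ K} {i : ℕ}
    (hL : L.IsHomogeneous i) (q : MvPolynomial σ K) (j : ℕ) :
    homogeneousComponent (i + j) (L * q) = L * homogeneousComponent j q := by
  have h := DirectSum.coe_decompose_mul_add_of_left_mem (homogeneousSubmodule σ K)
    (a := L) (b := q) (i := i) (j := j) hL
  have e (φ : MvPolynomial σ K) (k : ℕ) :
      (DirectSum.decompose (homogeneousSubmodule σ K) φ k : MvPolynomial σ K) =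
        homogeneousComponent k φ := decomposition.decompose'_apply φ k
  rwa [e, e] at h

/-- A form divisible by a linear form is zero or has a homogeneous quotient. -/
lemma exists_homogeneous_quotient {σ : Type*} {L p : MvPolynomial σ K} {d : ℕ}
    (hL : L.IsHomogeneous 1) (hp : p.IsHomogeneous d) (h : L ∣ p) :
    p = 0 ∨ ∃ e q, d = e + 1 ∧ q.IsHomogeneous e ∧ p = L * q := by
  obtain ⟨q, rfl⟩ := h
  cases d with
  | zero =>
    left
    rw [← homogeneousComponent_eq_self hp, homogeneousComponent_zero, ← constantCoeff_eq, map_mul,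
      constantCoeff_eq, hL.coeff_eq_zero (by simp)]
    simp
  | succ e =>
    right
    refine ⟨e, homogeneousComponent e q, rfl, homogeneousComponent_isHomogeneous e q, ?_⟩
    rw [← homogeneousComponent_mul_of_isHomogeneous hL, add_comm, homogeneousComponent_eq_self hp]

/-- If two algebra maps agree on the variables modulo `L`, they agree modulo `L`. -/
lemma dvd_sub_of_dvd_sub_X {σ A : Type*} [CommRing A] [Algebra K A] {L : A}
    {F G : MvPolynomial σ K →ₐ[K] A} (h : ∀ i, L ∣ F (X i) - G (X i)) (p : MvPolynomial σ K) :
    L ∣ F p - G p := by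
  have e : (Ideal.Quotient.mkₐ K (Ideal.span {L})).comp F =
      (Ideal.Quotient.mkₐ K (Ideal.span {L})).comp G := by
    ext i
    simpa [Ideal.Quotient.eq, Ideal.mem_span_singleton] using h i
  have := DFunLike.congr_fun e p
  simpa [Ideal.Quotient.eq, Ideal.mem_span_singleton] using this

lemma le_of_mem_support_of_X_pow_dvd {σ : Type*} {p : MvPolynomial σ K} {i : σ} {m : ℕ}
    (h : X i ^ m ∣ p) {v : σ →₀ ℕ} (hv : v ∈ p.support) : m ≤ v i := by
  obtain ⟨q, rfl⟩ := h
  rw [mem_support_iff, X_pow_eq_monomial, coeff_monomial_mul'] at hv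
  have : Finsupp.single i m ≤ v := by by_contra h; simp [h] at hv
  simpa using this i

/-- Specializing `s` to `b` turns the order of vanishing along `s` into divisibility by `b`. -/
lemma pow_dvd_of_pow_dvd_of_specialize {σ A : Type*} [CommRing A] [Algebra K A]
    {θ : MvPolynomial σ K →ₐ[K] Polynomial (MvPolynomial σ K)} {ρ τ : MvPolynomial σ K →ₐ[K] A}
    {b : A} (h : ∀ i, (θ (X i)).eval₂ τ.toRingHom b = ρ (X i)) {m : ℕ} {p : MvPolynomial σ K}
    (hp : Polynomial.X ^ m ∣ θ p) : b ^ m ∣ ρ p := by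
  have e : (Polynomial.eval₂RingHom τ.toRingHom b).comp θ.toRingHom = ρ.toRingHom := by
    refine ringHom_ext (fun r => ?_) fun i => by simpa using h i
    have h1 : θ (C r) = Polynomial.C (C r) := θ.commutes r
    have h2 : τ (C r) = algebraMap K A r := τ.commutes r
    have h3 : ρ (C r) = algebraMap K A r := ρ.commutes r
    simp [h1, h2, h3]
  have := map_dvd (Polynomial.eval₂RingHom τ.toRingHom b) hp
  rw [show Polynomial.eval₂RingHom τ.toRingHom b (θ p) = ρ p from DFunLike.congr_fun e p] at this
  simpa [map_pow] using this

lemma X_zero_sub_X_one_mul_mem_lineSpan {e : ℕ} {m : Fin 4 → ℕ} {q : MvPolynomial (Fin 3) K}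
    (hq : q ∈ lineSpan K e ![m 0 - 1, m 1 - 1, m 2, m 3]) :
    (X 0 - X 1) * q ∈ lineSpan K (e + 1) m := by
  induction hq using Submodule.span_induction with
  | zero => simp
  | add x y _ _ hx hy => rw [mul_add]; exact add_mem hx hy
  | smul c x _ hx => rw [mul_smul_comm]; exact Submodule.smul_mem _ _ hx
  | mem x hx =>
    obtain ⟨a, rfl, hm, rfl⟩ := hx
    refine Submodule.subset_span ⟨![a 0, a 1, a 2, a 3, a 4, a 5 + 1], ?_, ?_, ?_⟩
    · simp [Fin.sum_univ_six, add_assoc]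
    · simp [Fin.forall_fin_succ, lineOrder] at hm ⊢
      omega
    · simp [lineMonomial, pow_succ]; ring

lemma X_two_mul_mem_lineSpan {e : ℕ} {m : Fin 4 → ℕ} {q : MvPolynomial (Fin 3) K}
    (hq : q ∈ lineSpan K e ![m 0, m 1, m 2 - 1, m 3 - 1]) :
    X 2 * q ∈ lineSpan K (e + 1) m := by
  induction hq using Submodule.span_induction with
  | zero => simp
  | add x y _ _ hx hy => rw [mul_add]; exact add_mem hx hy
  | smul c x _ hx => rw [mul_smul_comm]; exact Submodule.smul_mem _ _ hx
  | mem x hx =>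
    obtain ⟨a, rfl, hm, rfl⟩ := hx
    refine Submodule.subset_span ⟨![a 0, a 1, a 2 + 1, a 3, a 4, a 5], ?_, ?_, ?_⟩
    · simp [Fin.sum_univ_six]; ring
    · simp [Fin.forall_fin_succ, lineOrder] at hm ⊢
      omega
    · simp [lineMonomial, pow_succ]; ring

lemma sum_of_mem_support {d : ℕ} {p : MvPolynomial (Fin 3) K} (hp : p.IsHomogeneous d)
    {v : Fin 3 →₀ ℕ} (hv : v ∈ p.support) : v 0 + v 1 + v 2 = d := by
  have h : Finsupp.weight 1 v = d := hp (mem_support_iff.1 hv)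
  simpa [Finsupp.weight_apply, Finsupp.sum_fintype, Fin.sum_univ_three] using h

/-- A form with too many zeros on the line `z = 0` vanishes on it. -/
lemma X_two_dvd_of_mem_fatForms {d : ℕ} {m : Fin 4 → ℕ} {p : MvPolynomial (Fin 3) K}
    (hp : p ∈ fatForms K d m) (hd : d < m 2 + m 3) : X 2 ∣ p := by
  let ρ : MvPolynomial (Fin 3) K →ₐ[K] MvPolynomial (Fin 3) K := aeval ![X 0, X 1, 0]
  have h2 : X 1 ^ m 2 ∣ ρ p :=
    pow_dvd_of_pow_dvd_of_specialize (τ := aeval ![X 0, 1, 0])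
      (by simp [Fin.forall_fin_succ, blowup, ρ]) (hp.2 2)
  have h3 : X 0 ^ m 3 ∣ ρ p :=
    pow_dvd_of_pow_dvd_of_specialize (τ := aeval ![1, X 1, 0])
      (by simp [Fin.forall_fin_succ, blowup, ρ]) (hp.2 3)
  have hom : (ρ p).IsHomogeneous d := by
    have := hp.1.aeval (S := K) (τ := Fin 3) (n := 1) ![X 0, X 1, 0]
      (by simp [Fin.forall_fin_succ, isHomogeneous_X, isHomogeneous_zero])
    rw [one_mul] at this
    exact this
  have h0 : ρ p = 0 := by
    rw [← support_eq_empty, Finset.eq_empty_iff_forall_notMem]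
    intro v hv
    have := sum_of_mem_support hom hv
    have := le_of_mem_support_of_X_pow_dvd h2 hv
    have := le_of_mem_support_of_X_pow_dvd h3 hv
    omega
  have := dvd_sub_of_dvd_sub_X (L := X 2) (F := AlgHom.id K _) (G := ρ)
    (by simp [Fin.forall_fin_succ, ρ]) p
  simpa [h0] using this

/-- A form that can be prescribed on the line `x = y` agrees on it with a combination of products
of lines. -/
lemma exists_mem_lineSpan_dvd_sub {d : ℕ} {m : Fin 4 → ℕ} {p : MvPolynomial (Fin 3) K}
    (hp : p ∈ fatForms K d m) (hd : m 2 + m 3 ≤ d) :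
    ∃ g ∈ lineSpan K d m, X 0 - X 1 ∣ p - g := by
  let ρ : MvPolynomial (Fin 3) K →ₐ[K] MvPolynomial (Fin 3) K := aeval ![X 0, X 0, X 2 + X 0]
  let ψ : MvPolynomial (Fin 3) K →ₐ[K] MvPolynomial (Fin 3) K := aeval ![X 0, 0, X 2 - X 0]
  let η : MvPolynomial (Fin 3) K →ₐ[K] MvPolynomial (Fin 3) K := aeval ![X 0, X 0, X 2]
  have h0 : X 2 ^ m 0 ∣ ρ p :=
    pow_dvd_of_pow_dvd_of_specialize (τ := aeval ![X 2 + X 0 - 1, X 2 + X 0 - 1, X 2 + X 0])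
      (by simp [Fin.forall_fin_succ, blowup, ρ]) (hp.2 0)
  have h1 : X 0 ^ m 1 ∣ ρ p :=
    pow_dvd_of_pow_dvd_of_specialize (τ := aeval ![1, 1, X 2 + X 0])
      (by simp [Fin.forall_fin_succ, blowup, ρ]) (hp.2 1)
  have hom : (ρ p).IsHomogeneous d := by
    have := hp.1.aeval (S := K) (τ := Fin 3) (n := 1) ![X 0, X 0, X 2 + X 0]
      (by simp [Fin.forall_fin_succ, isHomogeneous_X, (isHomogeneous_X K _).add])
    rw [one_mul] at this
    exact this
  have hxy : (X 0 - X 1 : MvPolynomial (Fin 3) K) ∣ X 1 - X 0 := ⟨-1, by ring⟩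
  have hη (q : MvPolynomial (Fin 3) K) : X 0 - X 1 ∣ q - η q :=
    dvd_sub_of_dvd_sub_X (F := AlgHom.id K _) (G := η)
      (by simp [Fin.forall_fin_succ, η, hxy]) q
  have hψ : X 0 - X 1 ∣ p - ψ (ρ p) :=
    dvd_sub_of_dvd_sub_X (F := AlgHom.id K _) (G := ψ.comp ρ)
      (by simp [Fin.forall_fin_succ, ψ, ρ, hxy]) p
  have key : ∀ v ∈ (ρ p).support, ∃ g ∈ lineSpan K d m,
      X 0 - X 1 ∣ ψ (monomial v ((ρ p).coeff v)) - g := by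
    intro v hv
    have e := sum_of_mem_support hom hv
    have e0 := le_of_mem_support_of_X_pow_dvd h0 hv
    have e1 := le_of_mem_support_of_X_pow_dvd h1 hv
    set c := (ρ p).coeff v
    have hm : ψ (monomial v c) = C c * (X 0 ^ v 0 * 0 ^ v 1 * (X 2 - X 0) ^ v 2) := by
      simp only [ψ]
      rw [aeval_monomial, Finsupp.prod_fintype _ _ (by simp), Fin.prod_univ_three]
      simp [algebraMap_eq]
    by_cases hv1 : v 1 = 0
    · obtain ⟨i, j, k, l, hij, hkl, hik⟩ : ∃ i j k l, v 0 = i + j ∧ v 2 = k + l ∧ j + k = m 2 :=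
        ⟨v 0 - (m 2 - min (m 2) (v 2)), m 2 - min (m 2) (v 2), min (m 2) (v 2),
          v 2 - min (m 2) (v 2), by omega, by omega, by omega⟩
      refine ⟨(c * (-1) ^ k) • lineMonomial K ![i, j, 0, k, l, 0], Submodule.smul_mem _ _
        (Submodule.subset_span ⟨_, ?_, ?_, rfl⟩), ?_⟩
      · simp [Fin.sum_univ_six]; omega
      · simp [Fin.forall_fin_succ, lineOrder]; omega
      · have := hη (ψ (monomial v c) - (c * (-1) ^ k) • lineMonomial K ![i, j, 0, k, l, 0])
        rwa [show η (ψ (monomial v c) - (c * (-1) ^ k) • lineMonomial K ![i, j, 0, k, l, 0]) = 0 by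
          rw [hm, hv1, hij, hkl, smul_eq_C_mul]
          simp only [lineMonomial, η, map_sub, map_mul, map_pow, aeval_X, aeval_C, algebraMap_eq,
            Matrix.cons_val, map_neg, map_one]
          rw [← neg_sub (X 2 : MvPolynomial (Fin 3) K) (X 0), neg_pow (X 2 - X 0), pow_add, pow_add]
          have : ((-1) ^ k * (-1) ^ k : MvPolynomial (Fin 3) K) = 1 := by
            rw [← mul_pow]; simp
          linear_combination (-(C c * X 0 ^ i * X 0 ^ j * (X 2 - X 0) ^ k * (X 2 - X 0) ^ l)) *
            this, sub_zero] at this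
    · exact ⟨0, zero_mem _, by simp [hm, hv1]⟩
  choose! g hg hgd using key
  refine ⟨∑ v ∈ (ρ p).support, g v, sum_mem hg, ?_⟩
  have hs : ψ (ρ p) = ∑ v ∈ (ρ p).support, ψ (monomial v ((ρ p).coeff v)) := by
    rw [← map_sum, support_sum_monomial_coeff]
  have : p - ∑ v ∈ (ρ p).support, g v = (p - ψ (ρ p)) +
      ∑ v ∈ (ρ p).support, (ψ (monomial v ((ρ p).coeff v)) - g v) := by
    rw [Finset.sum_sub_distrib, ← hs]; ring
  rw [this]
  exact dvd_add hψ (Finset.dvd_sum hgd)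

/-- Forms with assigned multiplicities at the four points are combinations of products of the six
lines joining them. -/
theorem fatForms_le_lineSpan (d : ℕ) (m : Fin 4 → ℕ) : fatForms K d m ≤ lineSpan K d m := by
  induction d using Nat.strong_induction_on generalizing m with
  | _ d ih =>
  intro p hp
  by_cases hd : d < m 2 + m 3
  · obtain rfl | ⟨e, q, rfl, hq, rfl⟩ := exists_homogeneous_quotient (isHomogeneous_X K 2) hp.1
      (X_two_dvd_of_mem_fatForms hp hd)
    · exact zero_mem _
    · exact X_two_mul_mem_lineSpan
        (ih e (Nat.lt_succ_self e) _ ⟨hq, blowup_dvd_of_mul_X hp.2⟩)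
  · obtain ⟨g, hg, hgd⟩ := exists_mem_lineSpan_dvd_sub hp (not_lt.1 hd)
    have hpg := sub_mem hp (lineSpan_le_fatForms d m hg)
    rw [← sub_add_cancel p g]
    refine add_mem ?_ hg
    obtain h0 | ⟨e, q, rfl, hq, h⟩ := exists_homogeneous_quotient
      ((isHomogeneous_X K 0).sub (isHomogeneous_X K 1)) hpg.1 hgd
    · rw [h0]; exact zero_mem _
    · rw [h] at hpg ⊢
      exact X_zero_sub_X_one_mul_mem_lineSpan
        (ih e (Nat.lt_succ_self e) _ ⟨hq, blowup_dvd_of_mul_X_sub_X hpg.2⟩)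

end FatPoints

section Residue

variable {K : Type*} [Field K] {n : ℕ}

/-- The `K`-linear map picking from `p` the monomials with exponents congruent to `r` modulo `n`,
with exponents divided by `n`. -/
def residuePart (K : Type*) [Field K] (n : ℕ) (r : Fin 3 → ℕ) :
    MvPolynomial (Fin 3) K →ₗ[K] MvPolynomial (Fin 3) K :=
  (basisMonomials (Fin 3) K).constr K fun v =>
    if ∀ i, v i % n = r i then monomial (v.mapRange (· / n) (Nat.zero_div n)) 1 else 0

lemma residuePart_monomial (r : Fin 3 → ℕ) (v : Fin 3 →₀ ℕ) (c : K) :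
    residuePart K n r (monomial v c) =
      if ∀ i, v i % n = r i then monomial (v.mapRange (· / n) (Nat.zero_div n)) c else 0 := by
  have h : monomial v c = c • basisMonomials (Fin 3) K v := by
    rw [coe_basisMonomials, smul_monomial, smul_eq_mul, mul_one]
  rw [h, map_smul, residuePart, Module.Basis.constr_basis]
  split_ifs <;> simp [smul_monomial]

lemma residuePart_expand_mul (hn : 0 < n) (r : Fin 3 → ℕ) (a p : MvPolynomial (Fin 3) K) :
    residuePart K n r (expand n a * p) = a * residuePart K n r p := by
  induction a using induction_on' with
  | add a b ha hb => simp only [map_add, add_mul, ha, hb]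
  | monomial u c =>
    induction p using induction_on' with
    | add a b ha hb => simp only [map_add, mul_add, ha, hb]
    | monomial v b =>
      rw [expand_monomial, monomial_mul, residuePart_monomial, residuePart_monomial]
      simp only [Finsupp.add_apply, Finsupp.smul_apply, smul_eq_mul, Nat.mul_add_mod]
      split_ifs
      · rw [monomial_mul]
        congr 2
        ext i
        simp [Nat.mul_add_div hn]
      · simp

lemma coeff_residuePart (hn : 0 < n) {r : Fin 3 →₀ ℕ} (hr : ∀ i, r i < n)
    (p : MvPolynomial (Fin 3) K) (u : Fin 3 →₀ ℕ) :
    (residuePart K n r p).coeff u = p.coeff (n • u + r) := by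
  induction p using induction_on' with
  | add a b ha hb => simp only [map_add, coeff_add, ha, hb]
  | monomial v c =>
    rw [residuePart_monomial, coeff_monomial]
    by_cases h : v = n • u + r
    · subst h
      have h1 : ∀ i, (n • u + r) i % n = r i := by
        simp [Nat.mod_eq_of_lt, hr]
      have h2 : (n • u + r).mapRange (· / n) (Nat.zero_div n) = u := by
        ext i
        simp [Nat.mul_add_div hn, Nat.div_eq_of_lt, hr]
      rw [if_pos h1, if_pos rfl, h2, coeff_monomial, if_pos rfl]
    · rw [if_neg h]
      split_ifs with h1
      · rw [coeff_monomial, if_neg]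
        rintro rfl
        refine h ?_
        ext i
        simp [← h1 i, Nat.div_add_mod]
      · simp

lemma sum_residuePart (hn : 0 < n) (p : MvPolynomial (Fin 3) K) :
    ∑ r ∈ Fintype.piFinset fun _ : Fin 3 => Finset.range n,
      monomial (Finsupp.equivFunOnFinite.symm r) 1 * expand n (residuePart K n r p) = p := by
  induction p using induction_on' with
  | add a b ha hb => simp only [map_add, mul_add, Finset.sum_add_distrib, ha, hb]
  | monomial v c =>
    rw [Finset.sum_eq_single_of_mem (fun i => v i % n)
      (by simp [Nat.mod_lt _ hn])]
    · rw [residuePart_monomial, if_pos fun _ => rfl, expand_monomial, monomial_mul, one_mul]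
      congr 2
      ext i
      simp [Nat.mod_add_div]
    · intro r _ hr
      rw [residuePart_monomial, if_neg fun h => hr (funext fun i => (h i).symm), map_zero, mul_zero]

/-- The ideal of the point `[1:1:1]`. -/
def idealOnes (K : Type*) [Field K] : Ideal (MvPolynomial (Fin 3) K) :=
  Ideal.span {X 1 - X 2, X 2 - X 0}

lemma Ifg_eq_map : Ifg K n = (idealOnes K).map (expand n) := by
  simp [Ifg, idealOnes, Ideal.map_span, Set.image_insert_eq, pf, pg]

lemma residuePart_mem_idealOnes_pow (hn : 0 < n) {m : ℕ} {p : MvPolynomial (Fin 3) K}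
    (hp : p ∈ Ifg K n ^ m) (r : Fin 3 → ℕ) : residuePart K n r p ∈ idealOnes K ^ m := by
  rw [Ifg_eq_map, ← Ideal.map_pow, Ideal.map] at hp
  suffices h : ∀ w, residuePart K n r (w * p) ∈ idealOnes K ^ m by simpa using h 1
  induction hp using Submodule.span_induction with
  | zero => simp
  | add x y _ _ hx hy => intro w; rw [mul_add, map_add]; exact add_mem (hx w) (hy w)
  | mem x hx =>
    obtain ⟨a, ha, rfl⟩ := hx
    intro w
    rw [mul_comm, residuePart_expand_mul hn]
    exact Ideal.mul_mem_right _ _ ha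
  | smul c x _ hx => intro w; rw [smul_eq_mul, ← mul_assoc]; exact hx _

lemma pow_dvd_blowup_zero {m : ℕ} {p : MvPolynomial (Fin 3) K} (hp : p ∈ idealOnes K ^ m) :
    Polynomial.X ^ m ∣ blowup K 0 p := by
  have h : (idealOnes K).map (blowup K 0) ≤ Ideal.span {Polynomial.X} := by
    rw [idealOnes, Ideal.map_span, Ideal.span_le]
    rintro _ ⟨q, rfl | rfl, rfl⟩
    · exact Ideal.mem_span_singleton.2 ⟨.C (X 1 - X 2), by simp [blowup]⟩
    · exact Ideal.mem_span_singleton.2 ⟨.C (X 2 - X 0), by simp [blowup]; ring⟩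
  have := Ideal.pow_right_mono h m (by rw [← Ideal.map_pow]; exact Ideal.mem_map_of_mem _ hp)
  rwa [Ideal.span_singleton_pow, Ideal.mem_span_singleton] at this

attribute [local instance] MvPolynomial.gradedAlgebra in
lemma homogeneousComponent_mem_idealOnes_pow {m : ℕ} {p : MvPolynomial (Fin 3) K}
    (hp : p ∈ idealOnes K ^ m) (e : ℕ) : homogeneousComponent e p ∈ idealOnes K ^ m := by
  have h : (idealOnes K).IsHomogeneous (homogeneousSubmodule (Fin 3) K) := by
    refine Ideal.homogeneous_span _ _ ?_
    rintro _ (rfl | rfl)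
    · exact ⟨1, (isHomogeneous_X K _).sub (isHomogeneous_X K _)⟩
    · exact ⟨1, (isHomogeneous_X K _).sub (isHomogeneous_X K _)⟩
  have hm : (idealOnes K ^ m).IsHomogeneous (homogeneousSubmodule (Fin 3) K) := by
    induction m with
    | zero => rw [pow_zero, Ideal.one_eq_top]; exact Ideal.IsHomogeneous.top _
    | succ m ih =>
      rw [pow_succ]
      exact (ih (Ideal.pow_le_pow_right m.le_succ hp)).mul h
  exact homogeneousComponent_mem_of_mem hm hp e

lemma le_add_of_mem_support {i j : Fin 3} (m : ℕ) {p : MvPolynomial (Fin 3) K}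
    (hp : p ∈ (Ideal.span {X i, X j} : Ideal (MvPolynomial (Fin 3) K)) ^ m) {v : Fin 3 →₀ ℕ}
    (hv : v ∈ p.support) (hij : i ≠ j) : m ≤ v i + v j := by
  induction m generalizing p v with
  | zero => simp
  | succ m ih =>
    rw [pow_succ] at hp
    induction hp using Submodule.mul_induction_on' generalizing v with
    | mem_mul_mem a ha b hb =>
      obtain ⟨u, w, rfl⟩ := Ideal.mem_span_pair.1 hb
      have h {k : Fin 3} (hk : k = i ∨ k = j) (u : MvPolynomial (Fin 3) K)
          (h : v ∈ (a * u * X k).support) : m + 1 ≤ v i + v j := by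
        rw [mem_support_iff, coeff_mul_X'] at h
        split_ifs at h with hk'
        · have := ih (Ideal.mul_mem_right u _ ha) (mem_support_iff.2 h)
          rw [Finsupp.mem_support_iff] at hk'
          obtain rfl | rfl := hk
          · simp [hij] at this; omega
          · simp [hij.symm] at this; omega
        · exact absurd rfl h
      rw [mul_add, ← mul_assoc, ← mul_assoc] at hv
      obtain hv | hv := Finset.mem_union.1 (support_add hv)
      · exact h (.inl rfl) _ hv
      · exact h (.inr rfl) _ hv
    | add x _ y _ hx hy =>
      obtain hv | hv := Finset.mem_union.1 (support_add hv)
      · exact hx hv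
      · exact hy hv

lemma pow_dvd_blowup_of_support {c : ℕ} {q : MvPolynomial (Fin 3) K} {i j : Fin 3} {k : Fin 4}
    (hk : (k, i, j) = (1, 0, 1) ∨ (k, i, j) = (2, 1, 2) ∨ (k, i, j) = (3, 2, 0))
    (h : ∀ v ∈ q.support, c ≤ v i + v j) : Polynomial.X ^ c ∣ blowup K k q := by
  rw [← support_sum_monomial_coeff q, map_sum]
  refine Finset.dvd_sum fun v hv => (pow_dvd_pow _ (h v hv)).trans ?_
  generalize q.coeff v = b
  have e : blowup K k (monomial v b) = .C (C b) * ∏ l, blowup K k (X l) ^ v l := by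
    rw [monomial_eq, map_mul, Finsupp.prod_fintype _ _ (by simp), map_prod]
    simp only [map_pow]
    congr 1
    exact (blowup K k).commutes b
  rw [e, Fin.prod_univ_three]
  refine Dvd.dvd.mul_left ?_ _
  simp only [Prod.mk.injEq] at hk
  obtain ⟨rfl, rfl, rfl⟩ | ⟨rfl, rfl, rfl⟩ | ⟨rfl, rfl, rfl⟩ := hk
  · exact ⟨.C (X 0) ^ v 0 * .C (X 1) ^ v 1 * .C (X 2) ^ v 2, by simp [blowup]; ring⟩
  · exact ⟨.C (X 0) ^ v 0 * .C (X 1) ^ v 1 * .C (X 2) ^ v 2, by simp [blowup]; ring⟩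
  · exact ⟨.C (X 0) ^ v 0 * .C (X 1) ^ v 1 * .C (X 2) ^ v 2, by simp [blowup]; ring⟩

end Residue

/-- Monomials in `x`, `y`, `z`, `f`, `g`, `h`. -/
def fermatMonomial (K : Type*) [Field K] (n : ℕ) (b : Fin 6 → ℕ) : MvPolynomial (Fin 3) K :=
  X 0 ^ b 0 * X 1 ^ b 1 * X 2 ^ b 2 * pf K n ^ b 3 * pg K n ^ b 4 * ph K n ^ b 5

/-- The orders of `fermatMonomial K n b` with respect to the four ideals defining `symbPow`. -/
def fermatOrder (n : ℕ) : (Fin 6 → ℕ) →+ (Fin 4 → ℕ) where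
  toFun b := ![b 3 + b 4 + b 5, b 0 + b 1 + n * b 5, b 1 + b 2 + n * b 3, b 0 + b 2 + n * b 4]
  map_zero' := by ext i; revert i; simp [Fin.forall_fin_succ]
  map_add' a b := by ext i; revert i; simp [Fin.forall_fin_succ]; refine ⟨?_, ?_, ?_, ?_⟩ <;> ring

section Fermat

variable {K : Type*} [Field K] {n : ℕ}

lemma exists_le_add_mul_iff (hn : 0 < n) (m t : ℕ) : ∃ c, ∀ u, m ≤ t + n * u ↔ c ≤ u :=
  ⟨(m - t) ⌈/⌉ n, fun u => by rw [ceilDiv_le_iff_le_mul hn]; omega⟩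

lemma monomial_mul_expand_lineMonomial (r : Fin 3 → ℕ) (a : Fin 6 → ℕ) :
    monomial (Finsupp.equivFunOnFinite.symm r) 1 * expand n (lineMonomial K a) =
      fermatMonomial K n
        ![r 0 + n * a 0, r 1 + n * a 1, r 2 + n * a 2, a 3, a 4, a 5] := by
  rw [monomial_eq, Finsupp.prod_fintype _ _ (by simp), Fin.prod_univ_three]
  simp only [lineMonomial, fermatMonomial, map_mul, map_pow, map_sub, expand_X, Matrix.cons_val,
    pf, pg, ph, pow_add, pow_mul, Finsupp.equivFunOnFinite_symm_apply_apply, C_1]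
  ring

lemma coeff_add_mem_support {p : MvPolynomial (Fin 3) K} (hn : 0 < n) {r : Fin 3 → ℕ}
    (hr : ∀ i, r i < n) {e : ℕ} {v : Fin 3 →₀ ℕ}
    (hv : v ∈ (homogeneousComponent e (residuePart K n r p)).support) :
    n • v + Finsupp.equivFunOnFinite.symm r ∈ p.support := by
  rw [mem_support_iff, coeff_homogeneousComponent] at hv
  rw [mem_support_iff, ← coeff_residuePart hn (by simpa using hr)]
  exact fun h => hv (by split_ifs; exacts [h, rfl])

lemma mem_span_fermatMonomial (hn : 0 < n) {m : ℕ} {p : MvPolynomial (Fin 3) K}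
    (hp : p ∈ symbPow K n m) :
    p ∈ Submodule.span K {q | ∃ b, (∀ i, m ≤ fermatOrder n b i) ∧ q = fermatMonomial K n b} := by
  obtain ⟨⟨⟨h0, h1⟩, h2⟩, h3⟩ := hp
  rw [← sum_residuePart hn p]
  refine sum_mem fun r hr => ?_
  replace hr : ∀ i, r i < n := by simpa using hr
  obtain ⟨c₁, hc₁⟩ := exists_le_add_mul_iff hn m (r 0 + r 1)
  obtain ⟨c₂, hc₂⟩ := exists_le_add_mul_iff hn m (r 1 + r 2)
  obtain ⟨c₃, hc₃⟩ := exists_le_add_mul_iff hn m (r 2 + r 0)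
  rw [← sum_homogeneousComponent (residuePart K n r p), map_sum, Finset.mul_sum]
  refine sum_mem fun e _ => ?_
  have hq : homogeneousComponent e (residuePart K n r p) ∈ fatForms K e ![m, c₁, c₂, c₃] := by
    refine ⟨homogeneousComponent_isHomogeneous _ _, ?_⟩
    have h0 : Polynomial.X ^ m ∣ blowup K 0 (homogeneousComponent e (residuePart K n r p)) :=
      pow_dvd_blowup_zero
        (homogeneousComponent_mem_idealOnes_pow (residuePart_mem_idealOnes_pow hn h0 r) e)
    have h1 : Polynomial.X ^ c₁ ∣ blowup K 1 (homogeneousComponent e (residuePart K n r p)) := by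
      refine pow_dvd_blowup_of_support (.inl rfl) fun v hv => (hc₁ _).1 ?_
      have := le_add_of_mem_support m h1 (coeff_add_mem_support hn hr hv) (by decide)
      simp at this
      linarith
    have h2 : Polynomial.X ^ c₂ ∣ blowup K 2 (homogeneousComponent e (residuePart K n r p)) := by
      refine pow_dvd_blowup_of_support (.inr (.inl rfl)) fun v hv => (hc₂ _).1 ?_
      have := le_add_of_mem_support m h2 (coeff_add_mem_support hn hr hv) (by decide)
      simp at this
      linarith
    have h3 : Polynomial.X ^ c₃ ∣ blowup K 3 (homogeneousComponent e (residuePart K n r p)) := by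
      refine pow_dvd_blowup_of_support (.inr (.inr rfl)) fun v hv => (hc₃ _).1 ?_
      have := le_add_of_mem_support m h3 (coeff_add_mem_support hn hr hv) (by decide)
      simp at this
      linarith
    intro i
    revert i
    simp only [Fin.forall_fin_succ, IsEmpty.forall_iff, and_true]
    exact ⟨h0, h1, h2, h3⟩
  replace hq := fatForms_le_lineSpan _ _ hq
  generalize homogeneousComponent e (residuePart K n r p) = q at hq
  induction hq using Submodule.span_induction with
  | zero => simp
  | add x y _ _ hx hy => rw [map_add, mul_add]; exact add_mem hx hy
  | smul c x _ hx => rw [map_smul, mul_smul_comm]; exact Submodule.smul_mem _ _ hx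
  | mem x hx =>
    obtain ⟨a, rfl, ha, rfl⟩ := hx
    refine Submodule.subset_span ⟨_, ?_, monomial_mul_expand_lineMonomial r a⟩
    simp only [Fin.forall_fin_succ, IsEmpty.forall_iff, and_true] at ha ⊢
    obtain ⟨a0, a1, a2, a3⟩ := ha
    simp [lineOrder] at a0 a1 a2 a3
    rw [← hc₁] at a1
    rw [← hc₂] at a2
    rw [← hc₃] at a3
    simp [fermatOrder]
    exact ⟨a0, by linarith, by linarith, by linarith⟩

lemma pow_sub_pow_mem {A : Type*} [CommRing A] (x y : A) (n : ℕ) :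
    x ^ n - y ^ n ∈ (Ideal.span {x, y} : Ideal A) ^ n :=
  sub_mem (Ideal.pow_mem_pow (Ideal.subset_span (by simp)) n)
    (Ideal.pow_mem_pow (Ideal.subset_span (by simp)) n)

lemma fermatMonomial_mem_symbPow {m : ℕ} {b : Fin 6 → ℕ} (h : ∀ i, m ≤ fermatOrder n b i) :
    fermatMonomial K n b ∈ symbPow K n m := by
  simp only [Fin.forall_fin_succ, IsEmpty.forall_iff, and_true] at h
  obtain ⟨h0, h1, h2, h3⟩ := h
  simp [fermatOrder] at h0 h1 h2 h3
  have key {I : Ideal (MvPolynomial (Fin 3) K)} {p u v w : MvPolynomial (Fin 3) K} (q) {i j k l : ℕ}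
      (hu : u ∈ I) (hv : v ∈ I) (hw : w ∈ I ^ l) (hm : m ≤ i + j + l * k)
      (hp : p = u ^ i * v ^ j * w ^ k * q) : p ∈ I ^ m := by
    rw [hp]
    refine Ideal.mul_mem_right _ _ (Ideal.pow_le_pow_right hm ?_)
    rw [pow_add, pow_add, pow_mul]
    exact Ideal.mul_mem_mul (Ideal.mul_mem_mul (Ideal.pow_mem_pow hu _) (Ideal.pow_mem_pow hv _))
      (Ideal.pow_mem_pow hw _)
  have hf : pf K n ∈ Ifg K n := Ideal.subset_span (by simp)
  have hg : pg K n ∈ Ifg K n := Ideal.subset_span (by simp)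
  have hh : ph K n ∈ Ifg K n ^ 1 := by
    rw [pow_one, show ph K n = -(pf K n + pg K n) by simp only [pf, pg, ph]; ring]
    exact neg_mem (add_mem hf hg)
  refine ⟨⟨⟨?_, ?_⟩, ?_⟩, ?_⟩
  · refine key (k := b 5) (X 0 ^ b 0 * X 1 ^ b 1 * X 2 ^ b 2) hf hg hh (by rwa [one_mul]) ?_
    simp only [fermatMonomial]; ring
  · refine key (X 2 ^ b 2 * pf K n ^ b 3 * pg K n ^ b 4) (Ideal.subset_span (.inl rfl))
      (Ideal.subset_span (.inr rfl)) (pow_sub_pow_mem _ _ _) h1 ?_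
    simp only [fermatMonomial, ph]; ring
  · refine key (X 0 ^ b 0 * pg K n ^ b 4 * ph K n ^ b 5) (Ideal.subset_span (.inl rfl))
      (Ideal.subset_span (.inr rfl)) (pow_sub_pow_mem _ _ _) h2 ?_
    simp only [fermatMonomial, pf]; ring
  · refine key (X 1 ^ b 1 * pf K n ^ b 3 * ph K n ^ b 5) (Ideal.subset_span (.inl rfl))
      (Ideal.subset_span (.inr rfl)) (pow_sub_pow_mem _ _ _) (by rwa [add_comm (b 2)]) ?_
    simp only [fermatMonomial, pg]; ring

/-- The exponents `(b, m)` with `fermatMonomial K n b` in the `m`-th symbolic power, together with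
slack variables. -/
def fermatMonoid (n : ℕ) : AddSubmonoid ((Fin 6 → ℕ) × ℕ × (Fin 4 → ℕ)) :=
  AddMonoidHom.eqLocusM ((fermatOrder n).comp (AddMonoidHom.fst _ _))
    { toFun := fun x i => x.2.1 + x.2.2 i
      map_zero' := rfl
      map_add' := fun x y => by ext i; simp; ring }

lemma mem_fermatMonoid {x : (Fin 6 → ℕ) × ℕ × (Fin 4 → ℕ)} :
    x ∈ fermatMonoid n ↔ ∀ i, fermatOrder n x.1 i = x.2.1 + x.2.2 i :=
  funext_iff

lemma fermatMonoid_fg (n : ℕ) : AddMonoid.FG (fermatMonoid n) :=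
  (AddMonoid.fg_iff_addSubmonoid_fg _).2 (AddSubmonoid.fg_eqLocusM _ _)

lemma fermatMonomial_add (a b : Fin 6 → ℕ) :
    fermatMonomial K n (a + b) = fermatMonomial K n a * fermatMonomial K n b := by
  simp only [fermatMonomial, Pi.add_apply, pow_add]
  ring

/-- The monoid homomorphism `(b, m, s) ↦ fermatMonomial K n b * t ^ m`. -/
def fermatMonomialHom (K : Type*) [Field K] (n : ℕ) :
    Multiplicative ((Fin 6 → ℕ) × ℕ × (Fin 4 → ℕ)) →* Polynomial (MvPolynomial (Fin 3) K) where
  toFun x := Polynomial.monomial x.toAdd.2.1 (fermatMonomial K n x.toAdd.1)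
  map_one' := by simp [fermatMonomial]
  map_mul' x y := by
    rw [Polynomial.monomial_mul_monomial, ← fermatMonomial_add]
    rfl

/-- The algebra map sending the exponent `(b, m)` to `fermatMonomial K n b * t ^ m`. -/
def fermatHom (K : Type*) [Field K] (n : ℕ) :
    AddMonoidAlgebra K (fermatMonoid n) →ₐ[K] Polynomial (MvPolynomial (Fin 3) K) :=
  AddMonoidAlgebra.lift K _ _
    ((fermatMonomialHom K n).comp (AddMonoidHom.toMultiplicative (fermatMonoid n).subtype))

lemma fermatHom_single (x : fermatMonoid n) (c : K) :
    fermatHom K n (AddMonoidAlgebra.single x c) =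
      c • Polynomial.monomial x.1.2.1 (fermatMonomial K n x.1.1) :=
  AddMonoidAlgebra.lift_single _ _ _

lemma fermatHom_coeff_mem (q : AddMonoidAlgebra K (fermatMonoid n)) (i : ℕ) :
    (fermatHom K n q).coeff i ∈ symbPow K n i := by
  induction q using AddMonoidAlgebra.induction_linear with
  | zero => simp
  | add p q hp hq => rw [map_add, Polynomial.coeff_add]; exact add_mem hp hq
  | single x c =>
    rw [fermatHom_single, Polynomial.coeff_smul, Polynomial.coeff_monomial]
    split_ifs with h
    · refine Submodule.smul_of_tower_mem _ c (fermatMonomial_mem_symbPow fun j => ?_)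
      rw [← h, mem_fermatMonoid.1 x.2]
      exact Nat.le_add_right _ _
    · simp

lemma exists_fermatHom_eq (hn : 0 < n) {p : Polynomial (MvPolynomial (Fin 3) K)}
    (hp : ∀ i, p.coeff i ∈ symbPow K n i) : p ∈ (fermatHom K n).range := by
  rw [p.as_sum_support]
  refine sum_mem fun i _ => ?_
  have h := mem_span_fermatMonomial hn (hp i)
  generalize p.coeff i = q at h
  induction h using Submodule.span_induction with
  | zero => simp
  | add x y _ _ hx hy => rw [map_add]; exact add_mem hx hy
  | smul c x _ hx =>
    rw [← Polynomial.smul_monomial]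
    exact Subalgebra.smul_mem _ hx c
  | mem x hx =>
    obtain ⟨b, hb, rfl⟩ := hx
    refine ⟨AddMonoidAlgebra.single ⟨(b, i, fun j => fermatOrder n b j - i),
      mem_fermatMonoid.2 fun j => by simp [hb j]⟩ 1, ?_⟩
    exact (fermatHom_single _ _).trans (one_smul _ _)

end Fermat

/-- the symbolic Rees algebra of the Fermat ideal, i.e. the subring
`𝒮 = {p ∈ R[t] : ∀ i, coeff i p ∈ I^{(i)}}` of `R[t]`, is Noetherian. (Note that
`symbPow K n 0 = R`, matching `I^{(0)} = R`.) -/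
theorem fermat_symbolic_rees_noetherian {K : Type*} [Field K] (n : ℕ) (hn : 3 ≤ n)
    (hζ : ∃ ζ : K, IsPrimitiveRoot ζ n) (hinv : IsUnit (n : K))
    (S : Subring (Polynomial (MvPolynomial (Fin 3) K)))
    (hS : (S : Set (Polynomial (MvPolynomial (Fin 3) K))) =
      {p : Polynomial (MvPolynomial (Fin 3) K) | ∀ i : ℕ, p.coeff i ∈ symbPow K n i}) :
    IsNoetherianRing S := by
  have hmem (p) : p ∈ S ↔ ∀ i : ℕ, p.coeff i ∈ symbPow K n i := Set.ext_iff.1 hS p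
  have := fermatMonoid_fg n
  have : IsNoetherianRing (AddMonoidAlgebra K (fermatMonoid n)) :=
    Algebra.FiniteType.isNoetherianRing K _
  refine isNoetherianRing_of_surjective _ _
    ((fermatHom K n).toRingHom.codRestrict S fun q => (hmem _).2 (fermatHom_coeff_mem q)) ?_
  rintro ⟨p, hp⟩
  obtain ⟨q, rfl⟩ := exists_fermatHom_eq (by omega) ((hmem p).1 hp)
  exact ⟨q, rfl⟩
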